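/- Assume the loss satisfies ℓ(h,z) ∈ [0,K]. Fix a prior probability measure P on H, probability measures D_s, D_t on Z, and λ_t > 0. For samples S_s ∈ Z^{m_s} and S_t ∈ Z^{m_t}, let Q_s = Q̂^{λ_t}_s be the empirical Gibbs posterior with prior P, sample S_s and temperature λ_t, and let Q̂^{λ_t}_{s:t} be the empirical Gibbs posterior with prior Q_s, sample S_t and temperature λ_t. If S_s and S_t are independent i.i.d. samples from D_s and D_t respectively, and if for all such samples the loss covariance cov_{λ_t}(P,s,t) = cov_{h∼P}(e^{−λ_t L̂(h,S_s)}, e^{−λ_t L̂(h,S_t)}) is nonnegative, then E_{S_s,S_t}[L(Q̂^{λ_t}_{s:t}, D_s)] ≤ λ_t K²/(8 m_s) + L(P, D_s) and E_{S_s,S_t}[L(Q̂^{λ_t}_{s:t}, D_t)] ≤ λ_t K²/(8 m_t) + L(P, D_t). -/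

import Mathlib

open MeasureTheory Real

/-- Expected loss `L(h, D) = E_{z∼D} ℓ(h, z)`. -/
noncomputable def expLoss {H Z : Type*} [MeasurableSpace Z] (ℓ : H → Z → ℝ) (h : H)
    (D : Measure Z) : ℝ :=
  ∫ z, ℓ h z ∂D

/-- Empirical loss `L̂(h, S) = (1/m) ∑_{j=1}^m ℓ(h, z_j)`. -/
noncomputable def empLoss {H Z : Type*} (ℓ : H → Z → ℝ) {m : ℕ} (h : H) (S : Fin m → Z) : ℝ :=
  (∑ j, ℓ h (S j)) / m

/-- The measure with density with respect to `P` proportional to `e^{−g h}`. -/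
noncomputable def gibbs {H : Type*} [MeasurableSpace H] (P : Measure H) (g : H → ℝ) :
    Measure H :=
  P.withDensity fun h => ENNReal.ofReal (Real.exp (-g h) / ∫ h', Real.exp (-g h') ∂P)

lemma gibbs_eq_tilted {H : Type*} [MeasurableSpace H] (P : Measure H) (g : H → ℝ) :
    gibbs P g = P.tilted fun h => -g h := rfl

lemma integrable_exp_of_forall_le {α : Type*} [MeasurableSpace α] {μ : Measure α}
    [IsFiniteMeasure μ] {f : α → ℝ} (hf : Measurable f) {C : ℝ} (hC : ∀ x, f x ≤ C) :
    Integrable (fun x => Real.exp (f x)) μ :=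
  Integrable.of_bound hf.exp.aestronglyMeasurable (Real.exp C)
    (.of_forall fun x => by simpa using hC x)

lemma integrable_of_forall_mem_Icc {α : Type*} [MeasurableSpace α] {μ : Measure α}
    [IsFiniteMeasure μ] {f : α → ℝ} (hf : Measurable f) {a b : ℝ}
    (hab : ∀ x, f x ∈ Set.Icc a b) : Integrable f μ :=
  Integrable.of_mem_Icc a b hf.aemeasurable (.of_forall hab)

lemma integral_le_of_forall_le {α : Type*} [MeasurableSpace α] {μ : Measure α}
    [IsProbabilityMeasure μ] {f : α → ℝ} (hf : Integrable f μ) {C : ℝ} (hC : ∀ x, f x ≤ C) :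
    ∫ x, f x ∂μ ≤ C :=
  (integral_mono hf (integrable_const C) hC).trans_eq (by simp)

lemma exp_integral_le {α : Type*} [MeasurableSpace α] {μ : Measure α} [IsProbabilityMeasure μ]
    {f : α → ℝ} (hf : Integrable f μ) (hexp : Integrable (fun x => Real.exp (f x)) μ) :
    Real.exp (∫ x, f x ∂μ) ≤ ∫ x, Real.exp (f x) ∂μ :=
  convexOn_exp.map_integral_le continuous_exp.continuousOn isClosed_univ
    (.of_forall fun _ => Set.mem_univ _) hf hexp

/-- If `e^{-a}` and `e^{-b}` are nonnegatively correlated under `P`, then passing from `P` to its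
tilting by `-a - b` is controlled by an exponential moment under the tilting by `-b` alone. -/
lemma exp_integral_tilted_sub_le {H : Type*} [MeasurableSpace H] {P : Measure H}
    [IsProbabilityMeasure P] {a b v : H → ℝ} (ha : Measurable a) (hb : Measurable b)
    (hv : Measurable v) {A V : ℝ} (ha' : ∀ h, a h ∈ Set.Icc 0 A) (hb' : ∀ h, 0 ≤ b h)
    (hv' : ∀ h, v h ∈ Set.Icc 0 V)
    (hcov : (∫ h, Real.exp (-a h) ∂P) * ∫ h, Real.exp (-b h) ∂P ≤
      ∫ h, Real.exp (-a h + -b h) ∂P) :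
    Real.exp ((∫ h, v h ∂(P.tilted fun h => -a h + -b h)) - ∫ h, a h ∂P) ≤
      ∫ h, Real.exp (v h - a h) ∂(P.tilted fun h => -b h) := by
  have hab : Integrable (fun h => Real.exp (-a h + -b h)) P :=
    integrable_exp_of_forall_le (by fun_prop) (C := 0) fun h => by
      linarith [(ha' h).1, hb' h]
  have hia : Integrable (fun h => Real.exp (-a h)) P :=
    integrable_exp_of_forall_le (by fun_prop) (C := 0) fun h => by linarith [(ha' h).1]
  have hib : Integrable (fun h => Real.exp (-b h)) P :=
    integrable_exp_of_forall_le (by fun_prop) (C := 0) fun h => by linarith [hb' h]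
  have := isProbabilityMeasure_tilted hab
  have hJv := exp_integral_le (μ := P.tilted fun h => -a h + -b h)
    (integrable_of_forall_mem_Icc hv hv')
    (integrable_exp_of_forall_le hv fun h => (hv' h).2)
  have hJa : Real.exp (-∫ h, a h ∂P) ≤ ∫ h, Real.exp (-a h) ∂P := by
    rw [← integral_neg]
    exact exp_integral_le (integrable_of_forall_mem_Icc ha ha').neg hia
  rw [integral_exp_tilted] at hJv ⊢
  have hpab := integral_exp_pos hab
  have hpb := integral_exp_pos hib
  have hnum : ∫ h, Real.exp (((fun h => -b h) + fun h => v h - a h) h) ∂P =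
      ∫ h, Real.exp (((fun h => -a h + -b h) + v) h) ∂P := by
    congr with h
    simp only [Pi.add_apply]
    ring_nf
  rw [hnum]
  set N := ∫ h, Real.exp (((fun h => -a h + -b h) + v) h) ∂P
  have hN : 0 ≤ N := integral_nonneg fun h => (Real.exp_pos _).le
  rw [sub_eq_add_neg, Real.exp_add]
  calc _ ≤ N / (∫ h, Real.exp (-a h + -b h) ∂P) * ∫ h, Real.exp (-a h) ∂P := by gcongr
    _ ≤ N / ∫ h, Real.exp (-b h) ∂P := by
      rw [div_mul_eq_mul_div, div_le_div_iff₀ hpab hpb, mul_assoc]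
      gcongr

lemma measurable_integral_tilted {S H : Type*} [MeasurableSpace S] [MeasurableSpace H]
    {P : Measure H} [SFinite P] {g : S → H → ℝ} (hg : Measurable (Function.uncurry g))
    {v : H → ℝ} (hv : Measurable v) :
    Measurable fun s => ∫ h, v h ∂(P.tilted (g s)) := by
  simp_rw [integral_tilted, smul_eq_mul]
  have hden : Measurable fun s => ∫ h, Real.exp (g s h) ∂P :=
    (StronglyMeasurable.integral_prod_right (f := fun s h => Real.exp (g s h))
      hg.exp.stronglyMeasurable).measurable
  refine (StronglyMeasurable.integral_prod_right
    (f := fun s h => Real.exp (g s h) / (∫ h', Real.exp (g s h') ∂P) * v h)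
    (Measurable.stronglyMeasurable ?_)).measurable
  exact (hg.exp.div (hden.comp measurable_fst)).mul (hv.comp measurable_snd)

lemma integrable_integral_tilted {S H : Type*} [MeasurableSpace S] [MeasurableSpace H]
    {P : Measure H} [IsProbabilityMeasure P] {μ : Measure S} [IsFiniteMeasure μ]
    {g : S → H → ℝ} (hg : Measurable (Function.uncurry g)) {v : H → ℝ} (hv : Measurable v)
    {V : ℝ} (hv' : ∀ h, v h ∈ Set.Icc 0 V) :
    Integrable (fun s => ∫ h, v h ∂(P.tilted (g s))) μ := by
  refine Integrable.of_bound (measurable_integral_tilted hg hv).aestronglyMeasurable V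
    (.of_forall fun s => ?_)
  obtain ⟨h₀⟩ := P.nonempty_of_neZero
  have hV : 0 ≤ V := (hv' h₀).1.trans (hv' h₀).2
  calc ‖∫ h, v h ∂(P.tilted (g s))‖ ≤ V * (P.tilted (g s)).real Set.univ :=
        norm_integral_le_of_norm_le_const (.of_forall fun h => by
          rw [Real.norm_of_nonneg (hv' h).1]; exact (hv' h).2)
    _ ≤ V := mul_le_of_le_one_right hV measureReal_le_one

section Loss

variable {H Z : Type*} {ℓ : H → Z → ℝ} {K : ℝ}

lemma empLoss_mem_Icc (hb : ∀ h z, ℓ h z ∈ Set.Icc 0 K) {m : ℕ} (hm : 0 < m) (h : H)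
    (S : Fin m → Z) : empLoss ℓ h S ∈ Set.Icc 0 K := by
  refine ⟨div_nonneg (Finset.sum_nonneg fun j _ => (hb h (S j)).1) (by positivity), ?_⟩
  rw [empLoss, div_le_iff₀ (by positivity)]
  calc ∑ j, ℓ h (S j) ≤ ∑ _j : Fin m, K := Finset.sum_le_sum fun j _ => (hb h (S j)).2
    _ = K * m := by simp [mul_comm]

variable [MeasurableSpace H] [MeasurableSpace Z]

lemma expLoss_mem_Icc (hℓ : Measurable (Function.uncurry ℓ)) (hb : ∀ h z, ℓ h z ∈ Set.Icc 0 K)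
    (D : Measure Z) [IsProbabilityMeasure D] (h : H) : expLoss ℓ h D ∈ Set.Icc 0 K := by
  exact ⟨integral_nonneg fun z => (hb h z).1, integral_le_of_forall_le
    (integrable_of_forall_mem_Icc hℓ.of_uncurry_left (hb h)) fun z => (hb h z).2⟩

lemma measurable_empLoss (hℓ : Measurable (Function.uncurry ℓ)) {m : ℕ} :
    Measurable (Function.uncurry fun (S : Fin m → Z) (h : H) => empLoss ℓ h S) := by
  refine Measurable.div_const (Finset.measurable_fun_sum _ fun j _ => ?_) _
  exact hℓ.comp (measurable_snd.prodMk ((measurable_pi_apply j).comp measurable_fst))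

lemma measurable_expLoss (hℓ : Measurable (Function.uncurry ℓ)) (D : Measure Z) [SFinite D] :
    Measurable fun h => expLoss ℓ h D :=
  (StronglyMeasurable.integral_prod_right (f := ℓ) hℓ.stronglyMeasurable).measurable

lemma integral_empLoss (hℓ : Measurable (Function.uncurry ℓ)) (hb : ∀ h z, ℓ h z ∈ Set.Icc 0 K)
    (D : Measure Z) [IsProbabilityMeasure D] {m : ℕ} (hm : 0 < m) (h : H) :
    ∫ S, empLoss ℓ h S ∂(Measure.pi fun _ : Fin m => D) = expLoss ℓ h D := by
  have hℓh : Measurable (ℓ h) := hℓ.of_uncurry_left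
  simp_rw [empLoss, integral_div]
  rw [integral_finsetSum _ fun j _ => integrable_of_forall_mem_Icc (by fun_prop)
    fun S : Fin m → Z => hb h (S j)]
  have hj (j : Fin m) : ∫ S, ℓ h (S j) ∂(Measure.pi fun _ : Fin m => D) = expLoss ℓ h D :=
    integral_comp_eval (μ := fun _ : Fin m => D) hℓh.aestronglyMeasurable
  simp_rw [hj]
  simp [field]

/-- Hoeffding's lemma for the generalization gap of a fixed hypothesis. -/
lemma integral_exp_expLoss_sub_empLoss_le (hℓ : Measurable (Function.uncurry ℓ))
    (hb : ∀ h z, ℓ h z ∈ Set.Icc 0 K) (D : Measure Z) [IsProbabilityMeasure D] {m : ℕ}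
    (hm : 0 < m) (lam : ℝ) (h : H) :
    ∫ S, Real.exp (lam * expLoss ℓ h D - lam * empLoss ℓ h S) ∂(Measure.pi fun _ : Fin m => D) ≤
      Real.exp (lam ^ 2 * K ^ 2 / (8 * m)) := by
  have hℓh : Measurable (ℓ h) := hℓ.of_uncurry_left
  have hsub (j : Fin m) : ProbabilityTheory.HasSubgaussianMGF
      (fun S : Fin m → Z => ℓ h (S j) - expLoss ℓ h D) ((‖K - 0‖₊ / 2) ^ 2)
      (Measure.pi fun _ : Fin m => D) := by
    have := ProbabilityTheory.hasSubgaussianMGF_of_mem_Icc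
      (μ := Measure.pi fun _ : Fin m => D) (X := fun S => ℓ h (S j)) (a := 0) (b := K)
      (hℓh.comp (measurable_pi_apply j)).aemeasurable (.of_forall fun S => hb h (S j))
    rwa [integral_comp_eval (μ := fun _ : Fin m => D) hℓh.aestronglyMeasurable] at this
  have hind : ProbabilityTheory.iIndepFun (fun j (S : Fin m → Z) => ℓ h (S j) - expLoss ℓ h D)
      (Measure.pi fun _ : Fin m => D) :=
    ProbabilityTheory.iIndepFun_pi (X := fun _ z => ℓ h z - expLoss ℓ h D) fun _ => by fun_prop
  have hmgf := (ProbabilityTheory.HasSubgaussianMGF.sum_of_iIndepFun hind (s := Finset.univ)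
    fun j _ => hsub j).mgf_le (-(lam / m))
  have hm0 : (m : ℝ) ≠ 0 := by positivity
  convert hmgf using 1
  · refine integral_congr_ae (.of_forall fun S => ?_)
    simp only [empLoss, Finset.sum_sub_distrib, Finset.sum_const, Finset.card_univ,
      Fintype.card_fin, nsmul_eq_mul]
    congr 1
    field_simp
    ring
  · simp only [Finset.sum_const, Finset.card_univ, Fintype.card_fin, sub_zero, nsmul_eq_mul]
    push_cast
    rw [div_pow, Real.norm_eq_abs, sq_abs]
    congr 1
    field_simp
    ring

/-- Expected loss of the Gibbs posterior when an additional potential `b`, nonnegatively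
correlated with the empirical loss, is included in the tilting. -/
lemma integral_expLoss_tilted_le (hℓ : Measurable (Function.uncurry ℓ))
    (hb : ∀ h z, ℓ h z ∈ Set.Icc 0 K) {P : Measure H} [IsProbabilityMeasure P]
    (D : Measure Z) [IsProbabilityMeasure D] {lam : ℝ} (hlam : 0 < lam) {m : ℕ} (hm : 0 < m)
    {b : H → ℝ} (hbm : Measurable b) (hb0 : ∀ h, 0 ≤ b h)
    (hcov : ∀ S : Fin m → Z,
      (∫ h, Real.exp (-(lam * empLoss ℓ h S)) ∂P) * ∫ h, Real.exp (-b h) ∂P ≤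
        ∫ h, Real.exp (-(lam * empLoss ℓ h S) + -b h) ∂P) :
    ∫ S, (∫ h, expLoss ℓ h D ∂(P.tilted fun h => -(lam * empLoss ℓ h S) + -b h))
        ∂(Measure.pi fun _ : Fin m => D) ≤
      lam * K ^ 2 / (8 * m) + ∫ h, expLoss ℓ h D ∂P := by
  set μ := Measure.pi fun _ : Fin m => D
  set c := lam ^ 2 * K ^ 2 / (8 * m) with hc
  have hemp := measurable_empLoss hℓ (m := m)
  have hexpL := measurable_expLoss hℓ D
  have hLb := expLoss_mem_Icc hℓ hb D
  have hprob : IsProbabilityMeasure (P.tilted fun h => -b h) :=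
    isProbabilityMeasure_tilted
      (integrable_exp_of_forall_le hbm.neg (C := 0) fun h => by linarith [hb0 h])
  have hscale {x : ℝ} (hx : x ∈ Set.Icc 0 K) : lam * x ∈ Set.Icc 0 (lam * K) :=
    ⟨mul_nonneg hlam.le hx.1, mul_le_mul_of_nonneg_left hx.2 hlam.le⟩
  have hpoint (S : Fin m → Z) :
      lam * (∫ h, expLoss ℓ h D ∂(P.tilted fun h => -(lam * empLoss ℓ h S) + -b h)) -
          lam * (∫ h, empLoss ℓ h S ∂P) - c + 1 ≤
        Real.exp (-c) * ∫ h, Real.exp (lam * expLoss ℓ h D - lam * empLoss ℓ h S)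
          ∂(P.tilted fun h => -b h) := by
    have key := exp_integral_tilted_sub_le (P := P) (a := fun h => lam * empLoss ℓ h S)
      (v := fun h => lam * expLoss ℓ h D) (hemp.of_uncurry_left.const_mul lam) hbm
      (hexpL.const_mul lam) (fun h => hscale (empLoss_mem_Icc hb hm h S)) hb0
      (fun h => hscale (hLb h)) (hcov S)
    rw [integral_const_mul, integral_const_mul] at key
    refine (Real.add_one_le_exp _).trans ?_
    rw [sub_eq_add_neg, add_comm _ (-c), Real.exp_add]
    gcongr
  have hintG : Integrable (fun S =>
      ∫ h, expLoss ℓ h D ∂(P.tilted fun h => -(lam * empLoss ℓ h S) + -b h)) μ :=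
    integrable_integral_tilted (g := fun S h => -(lam * empLoss ℓ h S) + -b h)
      ((hemp.const_mul lam).neg.add (hbm.comp measurable_snd).neg) hexpL hLb
  have hprodA : Integrable (Function.uncurry fun S h => empLoss ℓ h S) (μ.prod P) :=
    integrable_of_forall_mem_Icc hemp fun p => empLoss_mem_Icc hb hm p.2 p.1
  have hprodY : Integrable (Function.uncurry fun (S : Fin m → Z) h =>
      Real.exp (lam * expLoss ℓ h D - lam * empLoss ℓ h S))
      (μ.prod (P.tilted fun h => -b h)) :=
    integrable_exp_of_forall_le (f := fun p : (Fin m → Z) × H =>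
        lam * expLoss ℓ p.2 D - lam * empLoss ℓ p.2 p.1) (C := lam * K)
      (((hexpL.comp measurable_snd).const_mul lam).sub (hemp.const_mul lam)) fun p => by
        linarith [(hscale (hLb p.2)).2, (hscale (empLoss_mem_Icc hb hm p.2 p.1)).1]
  have hintA : Integrable (fun S => ∫ h, empLoss ℓ h S ∂P) μ := hprodA.integral_prod_left
  have hintY := hprodY.integral_prod_left
  have hA : ∫ S, (∫ h, empLoss ℓ h S ∂P) ∂μ = ∫ h, expLoss ℓ h D ∂P := by
    rw [integral_integral_swap hprodA]
    simp_rw [μ, integral_empLoss hℓ hb D hm]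
  have hY : ∫ S, (∫ h, Real.exp (lam * expLoss ℓ h D - lam * empLoss ℓ h S)
      ∂(P.tilted fun h => -b h)) ∂μ ≤ Real.exp c := by
    rw [integral_integral_swap hprodY]
    exact integral_le_of_forall_le hprodY.integral_prod_right
      fun h => integral_exp_expLoss_sub_empLoss_le hℓ hb D hm lam h
  have hdiff : Integrable (fun S =>
      lam * (∫ h, expLoss ℓ h D ∂(P.tilted fun h => -(lam * empLoss ℓ h S) + -b h)) -
        lam * ∫ h, empLoss ℓ h S ∂P) μ := (hintG.const_mul lam).sub (hintA.const_mul lam)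
  have hdiffc := hdiff.sub (integrable_const c)
  have hmain := integral_mono (hdiffc.add (integrable_const 1))
    (hintY.const_mul (Real.exp (-c))) hpoint
  rw [integral_add' hdiffc (integrable_const 1), integral_sub' hdiff (integrable_const c),
    integral_sub (hintG.const_mul lam) (hintA.const_mul lam)] at hmain
  simp only [Function.uncurry, integral_const_mul, hA, integral_const, probReal_univ,
    one_smul] at hmain
  have hone : Real.exp (-c) * Real.exp c = 1 := by rw [← Real.exp_add]; simp
  have hle := hmain.trans (mul_le_mul_of_nonneg_left hY (Real.exp_pos (-c)).le)
  have hclam : c = lam * (lam * K ^ 2 / (8 * m)) := by rw [hc]; ring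
  refine le_of_mul_le_mul_left ?_ hlam
  rw [mul_add, ← hclam]
  linarith

end Loss

/-- Corollary (related tasks, two-task covariance bound).  With `[0,K]`-bounded loss, prior `P`,
`Q_s` the empirical Gibbs posterior on `S_s` and `Q̂^{λ_t}_{s:t}` the empirical Gibbs posterior
with prior `Q_s` on `S_t`, if for all samples the loss covariance
`cov_{h∼P}(e^{−λ_t L̂(h,S_s)}, e^{−λ_t L̂(h,S_t)})` is nonnegative, then
`E_{S_s,S_t} L(Q̂^{λ_t}_{s:t}, D_s) ≤ λ_t K²/(8 m_s) + L(P, D_s)` and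
`E_{S_s,S_t} L(Q̂^{λ_t}_{s:t}, D_t) ≤ λ_t K²/(8 m_t) + L(P, D_t)`. -/
theorem gibbs_two_task_covariance {H Z : Type*} [MeasurableSpace H] [MeasurableSpace Z]
    (ℓ : H → Z → ℝ) (hℓ : Measurable (Function.uncurry ℓ))
    (K : ℝ) (hb : ∀ h z, ℓ h z ∈ Set.Icc 0 K)
    (P : Measure H) [IsProbabilityMeasure P]
    (Ds Dt : Measure Z) [IsProbabilityMeasure Ds] [IsProbabilityMeasure Dt]
    (lamt : ℝ) (hlam : 0 < lamt) (ms mt : ℕ) (hms : 0 < ms) (hmt : 0 < mt)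
    (hcov : ∀ (Ss : Fin ms → Z) (St : Fin mt → Z),
      0 ≤ (∫ h, Real.exp (-(lamt * empLoss ℓ h Ss)) * Real.exp (-(lamt * empLoss ℓ h St)) ∂P) -
        (∫ h, Real.exp (-(lamt * empLoss ℓ h Ss)) ∂P) *
          ∫ h, Real.exp (-(lamt * empLoss ℓ h St)) ∂P) :
    (∫ Spair, (∫ h, expLoss ℓ h Ds
          ∂(gibbs (gibbs P fun h => lamt * empLoss ℓ h Spair.1)
              fun h => lamt * empLoss ℓ h Spair.2))
        ∂((Measure.pi fun _ : Fin ms => Ds).prod (Measure.pi fun _ : Fin mt => Dt))) ≤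
      lamt * K ^ 2 / (8 * ms) + (∫ h, expLoss ℓ h Ds ∂P) ∧
    (∫ Spair, (∫ h, expLoss ℓ h Dt
          ∂(gibbs (gibbs P fun h => lamt * empLoss ℓ h Spair.1)
              fun h => lamt * empLoss ℓ h Spair.2))
        ∂((Measure.pi fun _ : Fin ms => Ds).prod (Measure.pi fun _ : Fin mt => Dt))) ≤
      lamt * K ^ 2 / (8 * mt) + ∫ h, expLoss ℓ h Dt ∂P := by
  have hms' := measurable_empLoss hℓ (m := ms)
  have hmt' := measurable_empLoss hℓ (m := mt)
  have hnn {m : ℕ} (hm : 0 < m) (S : Fin m → Z) (h : H) : 0 ≤ lamt * empLoss ℓ h S :=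
    mul_nonneg hlam.le (empLoss_mem_Icc hb hm h S).1
  have hgibbs (p : (Fin ms → Z) × (Fin mt → Z)) :
      (gibbs (gibbs P fun h => lamt * empLoss ℓ h p.1) fun h => lamt * empLoss ℓ h p.2) =
        P.tilted fun h => -(lamt * empLoss ℓ h p.1) + -(lamt * empLoss ℓ h p.2) := by
    rw [gibbs_eq_tilted, gibbs_eq_tilted, tilted_tilted]
    · rfl
    · exact integrable_exp_of_forall_le (hms'.of_uncurry_left.const_mul lamt).neg (C := 0)
        fun h => neg_nonpos.2 (hnn hms p.1 h)
  simp_rw [hgibbs]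
  have hint (D : Measure Z) [IsProbabilityMeasure D] :
      Integrable (fun p : (Fin ms → Z) × (Fin mt → Z) => ∫ h, expLoss ℓ h D
        ∂(P.tilted fun h => -(lamt * empLoss ℓ h p.1) + -(lamt * empLoss ℓ h p.2)))
        ((Measure.pi fun _ : Fin ms => Ds).prod (Measure.pi fun _ : Fin mt => Dt)) := by
    refine integrable_integral_tilted (g := fun (p : (Fin ms → Z) × (Fin mt → Z)) h =>
      -(lamt * empLoss ℓ h p.1) + -(lamt * empLoss ℓ h p.2)) ?_ (measurable_expLoss hℓ D)
      (expLoss_mem_Icc hℓ hb D)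
    exact ((hms'.comp (measurable_fst.fst.prodMk measurable_snd)).const_mul lamt).neg.add
      ((hmt'.comp (measurable_fst.snd.prodMk measurable_snd)).const_mul lamt).neg
  simp_rw [← Real.exp_add] at hcov
  constructor
  · rw [integral_prod_symm _ (hint Ds)]
    refine integral_le_of_forall_le (hint Ds).integral_prod_right fun St => ?_
    exact integral_expLoss_tilted_le hℓ hb Ds hlam hms (b := fun h => lamt * empLoss ℓ h St)
      (hmt'.of_uncurry_left.const_mul lamt) (hnn hmt St) fun Ss => sub_nonneg.1 (hcov Ss St)
  · rw [integral_prod _ (hint Dt)]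
    refine integral_le_of_forall_le (hint Dt).integral_prod_left fun Ss => ?_
    simp_rw [add_comm (-(lamt * empLoss ℓ _ Ss))]
    refine integral_expLoss_tilted_le hℓ hb Dt hlam hmt (b := fun h => lamt * empLoss ℓ h Ss)
      (hms'.of_uncurry_left.const_mul lamt) (hnn hms Ss) fun St => ?_
    simp_rw [add_comm (-(lamt * empLoss ℓ _ St))]
    rw [mul_comm]
    exact sub_nonneg.1 (hcov Ss St)
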